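/- Let I and J be set supercompositions. In the algebra of noncommutative superspace series of bounded degree, the product of the monomial quasisymmetric functions in noncommuting variables in superspace is M_I · M_J = Σ_{K ∈ QSh(I,J)} sgn(K) · M_K, the sum running over all (I,J)-quasi-shuffles K with their signs. Consequently, the set sNCQSym of quasisymmetric functions in noncommuting variables in superspace is closed under multiplication. -/

import Mathlib

/-- A noncommutative superspace monomial: `S` records the θ-indices (taken in increasing
order) and `w` is the word of `x`-indices. -/
structure NCMon where
  S : Finset ℕ
  w : List ℕ
deriving DecidableEq

namespace NCMon

/-- The set of indices of a noncommutative superspace monomial. -/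
def ind (u : NCMon) : Finset ℕ := u.S ∪ u.w.toFinset

/-- The total degree of a noncommutative superspace monomial. -/
def deg (u : NCMon) : ℕ := u.S.card + u.w.length

end NCMon

/-- The rank of `a` in the finite set `A`: the number of elements of `A` that are `≤ a`. -/
def rk (A : Finset ℕ) (a : ℕ) : ℕ := (A.filter (· ≤ a)).card

/-- Standardization of a monomial: relabel its indices via the unique order-preserving
bijection `ind u → {1, …, k}`. -/
def NCMon.std (u : NCMon) : NCMon := ⟨u.S.image (rk u.ind), u.w.map (rk u.ind)⟩

/-- The set supercomposition `I(u)` associated with a monomial `u`: its `r`-th block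
records the (1-indexed) positions of the `r`-th smallest index in the word, together
with `0` whenever that index is a θ-index. -/
def NCMon.scomp (u : NCMon) : List (Finset ℕ) :=
  (List.range u.ind.card).map fun r₀ =>
    (((Finset.range u.w.length).filter fun t => rk u.ind (u.w.getD t 0) = r₀ + 1).image (· + 1))
      ∪ (if r₀ + 1 ∈ u.S.image (rk u.ind) then ({0} : Finset ℕ) else ∅)

/-- The monomial quasisymmetric function in noncommuting variables in superspace:
the indicator function of the monomials whose set supercomposition is `I`. -/
def Mfn (I : List (Finset ℕ)) : NCMon → ℚ := fun u => if u.scomp = I then 1 else 0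

/-- Number of inversions between two θ-supports. -/
def invST (S T : Finset ℕ) : ℕ := ((S ×ˢ T).filter fun p => p.2 < p.1).card

/-- The product of coefficient functions, induced by the signed monomial product
`(S,w)·(T,v) = 0` if `S ∩ T ≠ ∅` and `(-1)^{inv(S,T)} (S ∪ T, w·v)` otherwise. -/
def mulF (f g : NCMon → ℚ) : NCMon → ℚ := fun m =>
  ∑ k ∈ Finset.range (m.w.length + 1), ∑ S₁ ∈ m.S.powerset,
    (-1 : ℚ) ^ invST S₁ (m.S \ S₁) * f ⟨S₁, m.w.take k⟩ * g ⟨m.S \ S₁, m.w.drop k⟩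

/-- Quasisymmetry in noncommuting variables in superspace: the coefficient of a monomial
depends only on its standardization. -/
def QSymNC (f : NCMon → ℚ) : Prop := ∀ u v : NCMon, u.std = v.std → f u = f v

/-- Bounded degree. -/
def BddDeg (f : NCMon → ℚ) : Prop := ∃ N, ∀ u : NCMon, f u ≠ 0 → u.deg ≤ N

/-- The set of nonzero elements appearing in the blocks of a sequence of subsets. -/
def unionNZ (I : List (Finset ℕ)) : Finset ℕ := (I.foldr (· ∪ ·) ∅).erase 0

/-- A set supercomposition: a sequence of nonempty subsets of `{0, …, n}`, pairwise
intersecting in at most `{0}`, whose union minus `{0}` equals `{1, …, n}`. Blocks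
containing `0` are the fermionic blocks. -/
def IsSSC (I : List (Finset ℕ)) : Prop :=
  (∀ B ∈ I, B.Nonempty) ∧ I.Pairwise (fun B C => B ∩ C ⊆ {0}) ∧
    unionNZ I = Finset.Icc 1 (unionNZ I).card

/-- Shift of a block: add `n` to every positive element. -/
def shiftB (n : ℕ) (B : Finset ℕ) : Finset ℕ := B.image fun a => if a = 0 then 0 else a + n

/-- The `n`-shift `J[n]` of a set supercomposition. -/
def shiftC (n : ℕ) (J : List (Finset ℕ)) : List (Finset ℕ) := J.map (shiftB n)

/-- `L` is an interleaving (shuffle) of the block sequences `I` (tagged `false`) and `J`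
(tagged `true`), preserving the relative order of the blocks of each. -/
def IsShuffle (I J : List (Finset ℕ)) (L : List (Bool × Finset ℕ)) : Prop :=
  ((L.filter fun p => !p.1).map Prod.snd) = I ∧ ((L.filter fun p => p.1).map Prod.snd) = J

/-- `ε(L)`: the number of pairs of fermionic blocks `(I_i, J_j[n])` such that `J_j[n]`
appears before `I_i` in the tagged shuffle `L`. -/
def eps (L : List (Bool × Finset ℕ)) : ℕ :=
  ((Finset.range L.length ×ˢ Finset.range L.length).filter fun pq =>
    pq.1 < pq.2 ∧ (L.getD pq.1 (false, ∅)).1 = true ∧ 0 ∈ (L.getD pq.1 (false, ∅)).2 ∧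
      (L.getD pq.2 (false, ∅)).1 = false ∧ 0 ∈ (L.getD pq.2 (false, ∅)).2).card

/-- `QMerge L K` : the set supercomposition `K` is obtained from the tagged shuffle `L` by
a possibly empty collection of mergers of a consecutive pair consisting of a block coming
from `I` followed by a block coming from `J`, not both fermionic, into their union. -/
inductive QMerge : List (Bool × Finset ℕ) → List (Finset ℕ) → Prop
  | nil : QMerge [] []
  | single (b : Bool) (B : Finset ℕ) (L : List (Bool × Finset ℕ)) (K : List (Finset ℕ)) :
      QMerge L K → QMerge ((b, B) :: L) (B :: K)
  | merge (B C : Finset ℕ) (L : List (Bool × Finset ℕ)) (K : List (Finset ℕ)) :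
      ¬(0 ∈ B ∧ 0 ∈ C) → QMerge L K →
      QMerge ((false, B) :: (true, C) :: L) ((B ∪ C) :: K)

/-- The block of positions of the index `a` in the monomial `u`, containing `0` when `a` is a
θ-index. -/
def NCMon.blk (u : NCMon) (a : ℕ) : Finset ℕ :=
  (((Finset.range u.w.length).filter fun t => u.w[t]? = some a).image (· + 1))
    ∪ (if a ∈ u.S then ({0} : Finset ℕ) else ∅)

theorem NCMon.zero_mem_blk (u : NCMon) (a : ℕ) : 0 ∈ u.blk a ↔ a ∈ u.S := by
  unfold NCMon.blk
  split_ifs with h <;> simp [h]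

theorem NCMon.succ_mem_blk (u : NCMon) (a t : ℕ) : t + 1 ∈ u.blk a ↔ u.w[t]? = some a := by
  have key : u.w[t]? = some a → t < u.w.length := fun h => (List.getElem?_eq_some_iff.mp h).1
  unfold NCMon.blk
  split_ifs with h <;> simpa using key

theorem NCMon.blk_nonempty (u : NCMon) (a : ℕ) : (u.blk a).Nonempty ↔ a ∈ u.ind := by
  unfold NCMon.ind
  rw [Finset.mem_union, List.mem_toFinset, List.mem_iff_getElem?]
  constructor
  · rintro ⟨_ | t, hx⟩
    · exact Or.inl ((u.zero_mem_blk a).mp hx)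
    · exact Or.inr ⟨t, (u.succ_mem_blk a t).mp hx⟩
  · rintro (h | ⟨t, h⟩)
    · exact ⟨0, (u.zero_mem_blk a).mpr h⟩
    · exact ⟨t + 1, (u.succ_mem_blk a t).mpr h⟩

theorem List.countP_le_getElem_of_sortedLT (l : List ℕ) (hl : l.Pairwise (· < ·)) (r : ℕ)
    (hr : r < l.length) : l.countP (· ≤ l[r]) = r + 1 := by
  induction l generalizing r with
  | nil => simp at hr
  | cons a l ih =>
    rw [List.pairwise_cons] at hl
    cases r with
    | zero =>
      have : l.countP (· ≤ a) = 0 := by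
        rw [List.countP_eq_zero]
        intro b hb
        simpa using hl.1 b hb
      simp [this]
    | succ r =>
      have hr' : r < l.length := by simpa using hr
      have h1 := hl.1 l[r] (List.getElem_mem _)
      simp [ih hl.2 r hr', h1.le]

theorem rk_eq_countP (A : Finset ℕ) (a : ℕ) : rk A a = (A.sort (· ≤ ·)).countP (· ≤ a) := by
  unfold rk
  conv_lhs => rw [← Finset.sort_toFinset (s := A) (r := (· ≤ ·))]
  rw [List.countP_eq_length_filter, ← List.toFinset_card_of_nodup
    ((Finset.sort_nodup _ _).filter _), List.toFinset_filter]
  simp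

theorem rk_sort_getElem (A : Finset ℕ) (r : ℕ) (hr : r < (A.sort (· ≤ ·)).length) :
    rk A (A.sort (· ≤ ·))[r] = r + 1 := by
  rw [rk_eq_countP]
  exact List.countP_le_getElem_of_sortedLT _ (Finset.sortedLT_sort A).pairwise r hr

theorem rk_strictMonoOn (A : Finset ℕ) : StrictMonoOn (rk A) A := by
  intro a _ b hb hab
  apply Finset.card_lt_card
  rw [Finset.ssubset_iff_of_subset]
  · exact ⟨b, by simpa using hb, by simp [hab]⟩
  · intro x
    simp only [Finset.mem_filter]
    rintro ⟨h1, h2⟩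
    exact ⟨h1, by omega⟩

theorem NCMon.scomp_eq_map_blk (u : NCMon) : u.scomp = (u.ind.sort (· ≤ ·)).map u.blk := by
  apply List.ext_getElem
  · simp [NCMon.scomp]
  · intro r h1 h2
    have hr : r < (u.ind.sort (· ≤ ·)).length := by simpa using h2
    have hmem : (u.ind.sort (· ≤ ·))[r] ∈ u.ind :=
      (Finset.mem_sort (· ≤ ·)).mp (List.getElem_mem hr)
    have hrk := rk_sort_getElem u.ind r hr
    simp only [NCMon.scomp, List.getElem_map, List.getElem_range]
    generalize (u.ind.sort (· ≤ ·))[r] = a at hmem hrk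
    have hinj : ∀ b ∈ u.ind, (rk u.ind b = r + 1 ↔ b = a) := fun b hb => by
      rw [← hrk]; exact (rk_strictMonoOn u.ind).injOn.eq_iff hb hmem
    unfold NCMon.blk
    congr 1
    · congr 1
      apply Finset.filter_congr
      intro t ht
      have ht' : t < u.w.length := by simpa using ht
      rw [List.getD_eq_getElem _ _ ht', List.getElem?_eq_getElem ht', Option.some_inj]
      exact hinj _ (by simp [NCMon.ind])
    · have : r + 1 ∈ u.S.image (rk u.ind) ↔ a ∈ u.S := by
        rw [Finset.mem_image]
        constructor
        · rintro ⟨b, hb, h⟩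
          rwa [← (hinj b (by simp [NCMon.ind, hb])).mp h]
        · exact fun h => ⟨a, h, hrk⟩
      simp [this]

theorem NCMon.scomp_eq_filter_map_blk (u : NCMon) (A : Finset ℕ) (hA : u.ind ⊆ A) :
    u.scomp = ((A.sort (· ≤ ·)).map u.blk).filter (· ≠ ∅) := by
  rw [u.scomp_eq_map_blk, List.filter_map]
  congr 1
  apply List.Perm.eq_of_pairwise' (r := (· ≤ ·))
  · exact Finset.pairwise_sort _ _
  · exact (Finset.pairwise_sort _ _).filter _
  · rw [List.perm_ext_iff_of_nodup (Finset.sort_nodup _ _) ((Finset.sort_nodup _ _).filter _)]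
    intro a
    simp only [Finset.mem_sort, List.mem_filter, Function.comp, decide_eq_true_eq,
      ← Finset.nonempty_iff_ne_empty, NCMon.blk_nonempty]
    exact ⟨fun h => ⟨hA h, h⟩, fun h => h.2⟩

theorem mem_foldr_union (I : List (Finset ℕ)) (x : ℕ) :
    x ∈ I.foldr (· ∪ ·) ∅ ↔ ∃ B ∈ I, x ∈ B := by
  induction I with
  | nil => simp
  | cons B I ih => simp [ih]

theorem NCMon.unionNZ_scomp (u : NCMon) : unionNZ u.scomp = Finset.Icc 1 u.w.length := by
  ext x
  rw [unionNZ, Finset.mem_erase, mem_foldr_union, u.scomp_eq_map_blk, Finset.mem_Icc]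
  cases x with
  | zero => simp
  | succ t =>
    simp only [List.mem_map, Finset.mem_sort]
    constructor
    · rintro ⟨-, _, ⟨a, -, rfl⟩, h⟩
      have := (List.getElem?_eq_some_iff.mp ((u.succ_mem_blk a t).mp h)).1
      omega
    · rintro ⟨-, h⟩
      have hb : t + 1 ∈ u.blk u.w[t] := (u.succ_mem_blk _ t).mpr (List.getElem?_eq_getElem _)
      exact ⟨by omega, _, ⟨_, (u.blk_nonempty _).mp ⟨_, hb⟩, rfl⟩, hb⟩

/-- The list holding the tagged block `(b, B)`, or no block at all if `B` is empty. -/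
def tagBlock (b : Bool) (B : Finset ℕ) : List (Bool × Finset ℕ) := if B = ∅ then [] else [(b, B)]

/-- The tagged sequence of blocks obtained by splitting each block `β a`, for `a` in `l`, into
`P a` (tagged `false`) followed by `β a \ P a` (tagged `true`) and omitting empty blocks. -/
def splitBlocks (l : List ℕ) (β P : ℕ → Finset ℕ) : List (Bool × Finset ℕ) :=
  l.flatMap fun a => tagBlock false (P a) ++ tagBlock true (β a \ P a)

theorem splitBlocks_cons (a : ℕ) (l : List ℕ) (β P : ℕ → Finset ℕ) :
    splitBlocks (a :: l) β P =
      tagBlock false (P a) ++ (tagBlock true (β a \ P a) ++ splitBlocks l β P) := by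
  simp [splitBlocks]

theorem splitBlocks_congr {l : List ℕ} {β P Q : ℕ → Finset ℕ} (h : ∀ a ∈ l, P a = Q a) :
    splitBlocks l β P = splitBlocks l β Q := by
  unfold splitBlocks
  rw [List.flatMap_def, List.flatMap_def]
  congr 1
  exact List.map_congr_left fun a ha => by rw [h a ha]

theorem isShuffle_splitBlocks (l : List ℕ) (β P : ℕ → Finset ℕ) :
    IsShuffle ((l.map P).filter (· ≠ ∅)) ((l.map fun a => β a \ P a).filter (· ≠ ∅))
      (splitBlocks l β P) := by
  induction l with
  | nil => simp [IsShuffle, splitBlocks]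
  | cons a l ih =>
    obtain ⟨h1, h2⟩ := ih
    rw [splitBlocks_cons]
    unfold IsShuffle tagBlock
    rw [List.map_cons, List.map_cons, List.filter_cons, List.filter_cons, ← h1, ← h2]
    constructor <;> split_ifs <;> simp_all

theorem qMerge_splitBlocks {l : List ℕ} {β P : ℕ → Finset ℕ} (hP : ∀ a ∈ l, P a ⊆ β a)
    (hβ : ∀ a ∈ l, β a ≠ ∅) : QMerge (splitBlocks l β P) (l.map β) := by
  induction l with
  | nil => exact QMerge.nil
  | cons a l ih =>
    have ih' := ih (fun b hb => hP b (List.mem_cons_of_mem _ hb))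
      (fun b hb => hβ b (List.mem_cons_of_mem _ hb))
    have ha := hP a List.mem_cons_self
    have hb := hβ a List.mem_cons_self
    rw [splitBlocks_cons, List.map_cons]
    unfold tagBlock
    by_cases h1 : P a = ∅
    · simp only [h1, Finset.sdiff_empty, hb, if_true, if_false]
      exact QMerge.single _ _ _ _ ih'
    · by_cases h2 : β a \ P a = ∅
      · have h3 : P a = β a := ha.antisymm (Finset.sdiff_eq_empty_iff_subset.mp h2)
        rw [if_neg h1, if_pos h2, h3]
        exact QMerge.single _ _ _ _ ih'
      · simp only [h1, h2, if_false]
        have := QMerge.merge (P a) (β a \ P a) _ _ (by simp +contextual) ih'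
        rwa [Finset.union_sdiff_of_subset ha] at this

theorem QMerge.exists_eq_splitBlocks {L : List (Bool × Finset ℕ)} {K : List (Finset ℕ)}
    (h : QMerge L K) (hne : ∀ p ∈ L, p.2 ≠ ∅)
    (hdisj : ∀ B C, (false, B) ∈ L → (true, C) ∈ L → ¬(0 ∈ B ∧ 0 ∈ C) → Disjoint B C)
    {l : List ℕ} (hl : l.Nodup) {β : ℕ → Finset ℕ} (hK : K = l.map β) :
    ∃ P : ℕ → Finset ℕ, (∀ a ∈ l, P a ⊆ β a) ∧ L = splitBlocks l β P := by
  induction h generalizing l with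
  | nil =>
    obtain rfl : l = [] := by simpa using hK.symm
    exact ⟨fun _ => ∅, by simp, rfl⟩
  | single b B L K _ ih =>
    cases l with
    | nil => simp at hK
    | cons a l =>
      simp only [List.map_cons, List.cons.injEq] at hK
      rw [List.nodup_cons] at hl
      obtain ⟨P, hP, hL⟩ := ih (fun p hp => hne p (List.mem_cons_of_mem _ hp))
        (fun B C hB hC => hdisj B C (List.mem_cons_of_mem _ hB) (List.mem_cons_of_mem _ hC))
        hl.2 hK.2
      have hB : B ≠ ∅ := hne _ List.mem_cons_self
      have hcongr : ∀ X, splitBlocks l β (Function.update P a X) = L := fun X => by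
        rw [hL]
        exact splitBlocks_congr fun c hc =>
          Function.update_of_ne (ne_of_mem_of_not_mem hc hl.1) _ _
      have hsub : ∀ X ⊆ β a, ∀ c ∈ a :: l, Function.update P a X c ⊆ β c := by
        intro X hX c hc
        rcases eq_or_ne c a with rfl | hca
        · simpa using hX
        · rw [Function.update_of_ne hca]
          exact hP c ((List.mem_cons.mp hc).resolve_left hca)
      cases b with
      | false =>
        refine ⟨Function.update P a B, hsub B hK.1.subset, ?_⟩
        rw [splitBlocks_cons, hcongr]
        simp [tagBlock, hB, hK.1.symm]
      | true =>
        refine ⟨Function.update P a ∅, hsub ∅ (by simp), ?_⟩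
        rw [splitBlocks_cons, hcongr]
        simp [tagBlock, hB, hK.1.symm]
  | merge B C L K h0 _ ih =>
    cases l with
    | nil => simp at hK
    | cons a l =>
      simp only [List.map_cons, List.cons.injEq] at hK
      rw [List.nodup_cons] at hl
      have hmem : ∀ {p}, p ∈ L → p ∈ (false, B) :: (true, C) :: L :=
        fun hp => List.mem_cons_of_mem _ (List.mem_cons_of_mem _ hp)
      obtain ⟨P, hP, hL⟩ := ih (fun p hp => hne p (hmem hp))
        (fun B C hB hC => hdisj B C (hmem hB) (hmem hC)) hl.2 hK.2
      have hB : B ≠ ∅ := hne (false, B) (by simp)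
      have hC : C ≠ ∅ := hne (true, C) (by simp)
      have hBC : Disjoint B C := hdisj B C (by simp) (by simp) h0
      refine ⟨Function.update P a B, ?_, ?_⟩
      · intro c hc
        rcases eq_or_ne c a with rfl | hca
        · simp [← hK.1]
        · rw [Function.update_of_ne hca]
          exact hP c ((List.mem_cons.mp hc).resolve_left hca)
      · have : splitBlocks l β (Function.update P a B) = L := by
          rw [hL]
          exact splitBlocks_congr fun c hc =>
            Function.update_of_ne (ne_of_mem_of_not_mem hc hl.1) _ _
        rw [splitBlocks_cons, this, Function.update_self, ← hK.1,
          Finset.union_sdiff_cancel_left hBC]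
        simp [tagBlock, hB, hC]

theorem splitBlocks_injOn {l : List ℕ} {β P Q : ℕ → Finset ℕ} (hβ : ∀ a ∈ l, β a ≠ ∅)
    (h : splitBlocks l β P = splitBlocks l β Q) : ∀ a ∈ l, P a = Q a := by
  induction l with
  | nil => simp
  | cons a l ih =>
    have hb := hβ a List.mem_cons_self
    rw [splitBlocks_cons, splitBlocks_cons] at h
    have hPQ : P a = Q a := by
      unfold tagBlock at h
      by_cases h1 : P a = ∅ <;> by_cases h2 : Q a = ∅
      · rw [h1, h2]
      · simp [h1, h2, hb] at h
      · simp [h1, h2, hb] at h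
      · simp only [h1, h2, if_false, List.cons_append, List.nil_append, List.cons.injEq,
          Prod.mk.injEq] at h
        exact h.1.2
    rw [hPQ, List.append_cancel_left_eq, List.append_cancel_left_eq] at h
    intro c hc
    rcases List.mem_cons.mp hc with rfl | hc
    · exact hPQ
    · exact ih (fun b hb => hβ b (List.mem_cons_of_mem _ hb)) h c hc

theorem List.card_filter_range_getD {α : Type*} (L : List α) (d : α) (p : α → Prop)
    [DecidablePred p] :
    ((Finset.range L.length).filter fun q => p (L.getD q d)).card = L.countP p := by
  induction L with
  | nil => simp
  | cons x L ih =>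
    rw [Finset.card_filter, List.length_cons, Finset.sum_range_succ', List.countP_cons, ← ih,
      Finset.card_filter]
    simp

theorem eps_cons (x : Bool × Finset ℕ) (L : List (Bool × Finset ℕ)) :
    eps (x :: L) = (if x.1 = true ∧ 0 ∈ x.2 then L.countP fun y => y.1 = false ∧ 0 ∈ y.2 else 0)
      + eps L := by
  have h := L.card_filter_range_getD (false, ∅) fun y => y.1 = false ∧ 0 ∈ y.2
  unfold eps
  rw [Finset.card_filter, Finset.sum_product, List.length_cons, Finset.sum_range_succ', ← h,
    Finset.card_filter, Finset.card_filter, Finset.sum_product, add_comm]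
  congr 1
  · rw [Finset.sum_range_succ']
    by_cases hx : x.1 = true ∧ 0 ∈ x.2
    · simp [hx]
    · rw [if_neg hx]
      simp only [List.getD_cons_succ, List.getD_cons_zero]
      rw [Finset.sum_eq_zero]
      · simp
      · intro q _
        rw [if_neg]
        tauto
  · refine Finset.sum_congr rfl fun p _ => ?_
    rw [Finset.sum_range_succ']
    simp

theorem eps_splitBlocks {l : List ℕ} (hl : l.Pairwise (· < ·)) (β P : ℕ → Finset ℕ)
    (S T : Finset ℕ) (hS : ∀ a ∈ l, 0 ∈ P a ↔ a ∈ S) (hT : ∀ a ∈ l, 0 ∈ β a \ P a ↔ a ∈ T) :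
    eps (splitBlocks l β P) = ∑ t ∈ T ∩ l.toFinset, ((S ∩ l.toFinset).filter (t < ·)).card ∧
    ((splitBlocks l β P).countP fun y => y.1 = false ∧ 0 ∈ y.2) = (S ∩ l.toFinset).card := by
  induction l with
  | nil => simp [splitBlocks, eps]
  | cons a l ih =>
    rw [List.pairwise_cons] at hl
    obtain ⟨ih1, ih2⟩ := ih hl.2 (fun b hb => hS b (List.mem_cons_of_mem _ hb))
      (fun b hb => hT b (List.mem_cons_of_mem _ hb))
    have hSa := hS a List.mem_cons_self
    have hTa := hT a List.mem_cons_self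
    have hal : a ∉ l := fun h => (hl.1 a h).false
    have hfalse : ∀ M, eps (tagBlock false (P a) ++ M) = eps M := by
      intro M
      unfold tagBlock
      split_ifs <;> simp [eps_cons]
    have htrue : ∀ M, eps (tagBlock true (β a \ P a) ++ M) =
        (if a ∈ T then M.countP fun y => y.1 = false ∧ 0 ∈ y.2 else 0) + eps M := by
      intro M
      unfold tagBlock
      simp only [← hTa]
      split_ifs with h1 h2 h2
      · simp [h1] at h2
      · simp
      · rw [List.singleton_append, eps_cons, if_pos ⟨rfl, h2⟩]
      · rw [List.singleton_append, eps_cons, if_neg (fun h => h2 h.2)]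
    have hcf : ((tagBlock false (P a)).countP fun y => y.1 = false ∧ 0 ∈ y.2) =
        if a ∈ S then 1 else 0 := by
      unfold tagBlock
      simp only [← hSa]
      by_cases h : P a = ∅ <;> simp [h, List.countP_cons]
    have hct : ((tagBlock true (β a \ P a)).countP fun y => y.1 = false ∧ 0 ∈ y.2) = 0 := by
      unfold tagBlock
      split_ifs <;> simp
    have hins : ∀ X : Finset ℕ, X ∩ (a :: l).toFinset =
        if a ∈ X then insert a (X ∩ l.toFinset) else X ∩ l.toFinset := by
      intro X
      rw [List.toFinset_cons]
      split_ifs with h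
      · exact Finset.inter_insert_of_mem h
      · exact Finset.inter_insert_of_notMem h
    have hfilter : ∀ t ∈ T ∩ l.toFinset,
        ((S ∩ (a :: l).toFinset).filter (t < ·)) = ((S ∩ l.toFinset).filter (t < ·)) := by
      intro t ht
      have : ¬ t < a := (hl.1 t (by simp at ht; exact ht.2)).not_gt
      rw [hins]
      split_ifs
      · rw [Finset.filter_insert, if_neg this]
      · rfl
    have hfirst : ((S ∩ (a :: l).toFinset).filter (a < ·)) = S ∩ l.toFinset := by
      have : ((S ∩ l.toFinset).filter (a < ·)) = S ∩ l.toFinset := by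
        apply Finset.filter_true_of_mem
        intro b hb
        exact hl.1 b (by simp at hb; exact hb.2)
      rw [hins]
      split_ifs
      · rw [Finset.filter_insert, if_neg (lt_irrefl a), this]
      · exact this
    rw [splitBlocks_cons, hfalse, htrue, List.countP_append, List.countP_append, hcf, hct, ih1, ih2]
    constructor
    · rw [hins T]
      split_ifs with h
      · rw [Finset.sum_insert (by simp [hal]), hfirst, Finset.sum_congr rfl
          fun t ht => congrArg Finset.card (hfilter t ht)]
      · rw [zero_add, Finset.sum_congr rfl fun t ht => congrArg Finset.card (hfilter t ht)]
    · rw [hins S]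
      split_ifs with h
      · rw [Finset.card_insert_of_notMem (by simp [hal])]
        omega
      · simp

theorem invST_eq_sum (S T : Finset ℕ) : invST S T = ∑ t ∈ T, (S.filter (t < ·)).card := by
  unfold invST
  rw [Finset.card_filter, Finset.sum_product_right]
  exact Finset.sum_congr rfl fun t _ => (Finset.card_filter _ _).symm

theorem zero_mem_shiftB (n : ℕ) (B : Finset ℕ) : 0 ∈ shiftB n B ↔ 0 ∈ B := by
  unfold shiftB
  rw [Finset.mem_image]
  constructor
  · rintro ⟨a, ha, h⟩
    split_ifs at h with h0
    · exact h0 ▸ ha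
    · omega
  · exact fun h => ⟨0, h, by simp⟩

theorem succ_mem_shiftB (n t : ℕ) (B : Finset ℕ) :
    t + 1 ∈ shiftB n B ↔ n ≤ t ∧ t - n + 1 ∈ B := by
  unfold shiftB
  rw [Finset.mem_image]
  constructor
  · rintro ⟨a, ha, h⟩
    split_ifs at h with h0
    have : t - n + 1 = a := by omega
    exact ⟨by omega, this ▸ ha⟩
  · rintro ⟨h, hB⟩
    exact ⟨_, hB, by rw [if_neg (by omega)]; omega⟩

theorem shiftB_injective (n : ℕ) : Function.Injective (shiftB n) := by
  apply Finset.image_injective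
  intro a b h
  dsimp only at h
  split_ifs at h <;> omega

theorem NCMon.blk_take_subset (m : NCMon) {S₁ : Finset ℕ} (hS : S₁ ⊆ m.S) (n a : ℕ) :
    NCMon.blk ⟨S₁, m.w.take n⟩ a ⊆ m.blk a := by
  rintro (_ | t) h
  · rw [NCMon.zero_mem_blk] at h ⊢
    exact hS h
  · rw [NCMon.succ_mem_blk, List.getElem?_take] at h
    rw [NCMon.succ_mem_blk]
    split_ifs at h
    exact h

theorem NCMon.blk_sdiff_blk_take (m : NCMon) (S₁ : Finset ℕ) (n a : ℕ) :
    m.blk a \ NCMon.blk ⟨S₁, m.w.take n⟩ a = shiftB n (NCMon.blk ⟨m.S \ S₁, m.w.drop n⟩ a) := by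
  ext (_ | t)
  · simp [zero_mem_shiftB, NCMon.zero_mem_blk]
  · rw [Finset.mem_sdiff, succ_mem_shiftB, NCMon.succ_mem_blk, NCMon.succ_mem_blk,
      NCMon.succ_mem_blk, List.getElem?_take, List.getElem?_drop]
    by_cases h : n ≤ t
    · simp [h, Nat.not_lt.mpr h]
    · simp [h, Nat.lt_of_not_le h]

/-- The tagged shuffle determined by splitting the θ-support of `m` as `S₁ ∪ (m.S \ S₁)` and its
word after the first `n` letters. -/
def NCMon.splitShuffle (m : NCMon) (n : ℕ) (S₁ : Finset ℕ) : List (Bool × Finset ℕ) :=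
  splitBlocks (m.ind.sort (· ≤ ·)) m.blk (NCMon.blk ⟨S₁, m.w.take n⟩)

theorem NCMon.blk_ne_empty_of_mem_sort (m : NCMon) :
    ∀ a ∈ m.ind.sort (· ≤ ·), m.blk a ≠ ∅ := fun a ha =>
  ((m.blk_nonempty a).mpr ((Finset.mem_sort (· ≤ ·)).mp ha)).ne_empty

theorem NCMon.isShuffle_splitShuffle (m : NCMon) (n : ℕ) {S₁ : Finset ℕ} (hS : S₁ ⊆ m.S) :
    IsShuffle (NCMon.scomp ⟨S₁, m.w.take n⟩)
      (shiftC n (NCMon.scomp ⟨m.S \ S₁, m.w.drop n⟩)) (m.splitShuffle n S₁) := by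
  have h := isShuffle_splitBlocks (m.ind.sort (· ≤ ·)) m.blk (NCMon.blk ⟨S₁, m.w.take n⟩)
  rw [NCMon.scomp_eq_filter_map_blk ⟨S₁, m.w.take n⟩ m.ind,
    NCMon.scomp_eq_filter_map_blk ⟨m.S \ S₁, m.w.drop n⟩ m.ind]
  · refine Eq.mp ?_ h
    unfold NCMon.splitShuffle
    congr 1
    simp only [NCMon.blk_sdiff_blk_take]
    unfold shiftC
    rw [← Function.comp_def (shiftB n), ← List.map_map, List.filter_map (f := shiftB n)]
    congr 2
    ext B
    simp [shiftB]
  · exact Finset.union_subset_union Finset.sdiff_subset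
      fun a => by simpa using List.mem_of_mem_drop
  · exact Finset.union_subset_union hS fun a => by simpa using List.mem_of_mem_take

theorem NCMon.qMerge_splitShuffle (m : NCMon) (n : ℕ) {S₁ : Finset ℕ} (hS : S₁ ⊆ m.S) :
    QMerge (m.splitShuffle n S₁) m.scomp := by
  rw [m.scomp_eq_map_blk]
  exact qMerge_splitBlocks (fun a _ => m.blk_take_subset hS n a) m.blk_ne_empty_of_mem_sort

theorem NCMon.eps_splitShuffle (m : NCMon) (n : ℕ) {S₁ : Finset ℕ} (hS : S₁ ⊆ m.S) :
    eps (m.splitShuffle n S₁) = invST S₁ (m.S \ S₁) := by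
  have h := (eps_splitBlocks (Finset.sortedLT_sort m.ind).pairwise m.blk
    (NCMon.blk ⟨S₁, m.w.take n⟩) S₁ (m.S \ S₁)
    (fun a _ => NCMon.zero_mem_blk _ a)
    (fun a _ => by rw [m.blk_sdiff_blk_take, zero_mem_shiftB, NCMon.zero_mem_blk])).1
  have hm : m.S ⊆ m.ind := Finset.subset_union_left
  rw [Finset.sort_toFinset, Finset.inter_eq_left.mpr (hS.trans hm),
    Finset.inter_eq_left.mpr (Finset.sdiff_subset.trans hm)] at h
  rw [invST_eq_sum]
  exact h

theorem NCMon.splitShuffle_injOn (m : NCMon) (n : ℕ) {S₁ S₂ : Finset ℕ} (h₁ : S₁ ⊆ m.S)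
    (h₂ : S₂ ⊆ m.S) (h : m.splitShuffle n S₁ = m.splitShuffle n S₂) : S₁ = S₂ := by
  have key := splitBlocks_injOn m.blk_ne_empty_of_mem_sort h
  have hm : m.S ⊆ m.ind := Finset.subset_union_left
  have aux : ∀ a ∈ m.S, a ∈ S₁ ↔ a ∈ S₂ := fun a ha => by
    have := key a ((Finset.mem_sort (· ≤ ·)).mpr (hm ha))
    rw [← NCMon.zero_mem_blk ⟨S₁, m.w.take n⟩, this, NCMon.zero_mem_blk]
  ext a
  exact ⟨fun ha => (aux a (h₁ ha)).mp ha, fun ha => (aux a (h₂ ha)).mpr ha⟩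

theorem IsShuffle.mem_left {I J : List (Finset ℕ)} {L : List (Bool × Finset ℕ)}
    (h : IsShuffle I J L) {B : Finset ℕ} (hB : (false, B) ∈ L) : B ∈ I := by
  rw [← h.1]
  exact List.mem_map.mpr ⟨_, List.mem_filter.mpr ⟨hB, rfl⟩, rfl⟩

theorem IsShuffle.mem_right {I J : List (Finset ℕ)} {L : List (Bool × Finset ℕ)}
    (h : IsShuffle I J L) {B : Finset ℕ} (hB : (true, B) ∈ L) : B ∈ J := by
  rw [← h.2]
  exact List.mem_map.mpr ⟨_, List.mem_filter.mpr ⟨hB, rfl⟩, rfl⟩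

theorem IsSSC.lt_of_succ_mem {I : List (Finset ℕ)} (hI : IsSSC I) {B : Finset ℕ} (hB : B ∈ I)
    {t : ℕ} (ht : t + 1 ∈ B) : t < (unionNZ I).card := by
  have : t + 1 ∈ unionNZ I := by
    rw [unionNZ, Finset.mem_erase, mem_foldr_union]
    exact ⟨by omega, B, hB, ht⟩
  rw [hI.2.2, Finset.mem_Icc] at this
  omega

theorem le_of_succ_mem_of_mem_shiftC {n : ℕ} {J : List (Finset ℕ)} {C : Finset ℕ}
    (hC : C ∈ shiftC n J) {t : ℕ} (ht : t + 1 ∈ C) : n ≤ t := by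
  obtain ⟨D, -, rfl⟩ := List.mem_map.mp hC
  exact ((succ_mem_shiftB n t D).mp ht).1

theorem exists_splitShuffle_eq {I J : List (Finset ℕ)} (hI : IsSSC I) (hJ : IsSSC J) {m : NCMon}
    {L : List (Bool × Finset ℕ)} (hL : IsShuffle I (shiftC (unionNZ I).card J) L)
    (hm : QMerge L m.scomp) :
    ∃ S₁ ⊆ m.S, NCMon.scomp ⟨S₁, m.w.take (unionNZ I).card⟩ = I ∧
      NCMon.scomp ⟨m.S \ S₁, m.w.drop (unionNZ I).card⟩ = J ∧
      m.splitShuffle (unionNZ I).card S₁ = L := by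
  set n := (unionNZ I).card with hn
  have hne : ∀ p ∈ L, p.2 ≠ ∅ := by
    rintro ⟨_ | _, B⟩ hp
    · exact (hI.1 B (hL.mem_left hp)).ne_empty
    · obtain ⟨D, hD, hDB⟩ := List.mem_map.mp (hL.mem_right hp)
      have := (hJ.1 D hD).image fun a => if a = 0 then 0 else a + n
      exact (hDB ▸ this : B.Nonempty).ne_empty
  obtain ⟨P, hP, hLP⟩ := hm.exists_eq_splitBlocks hne (by
    intro B C hB hC h0
    rw [Finset.disjoint_left]
    rintro (_ | t) h1 h2
    · exact h0 ⟨h1, h2⟩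
    · have := hI.lt_of_succ_mem (hL.mem_left hB) h1
      have := le_of_succ_mem_of_mem_shiftC (hL.mem_right hC) h2
      omega) (Finset.sort_nodup m.ind (· ≤ ·)) m.scomp_eq_map_blk
  set l := m.ind.sort (· ≤ ·) with hl
  have hmemP : ∀ a ∈ l, P a ≠ ∅ → P a ∈ I := fun a ha h => hL.mem_left <| by
    rw [hLP, splitBlocks, List.mem_flatMap]
    exact ⟨a, ha, by simp [tagBlock, h]⟩
  have hmemQ : ∀ a ∈ l, m.blk a \ P a ≠ ∅ → m.blk a \ P a ∈ shiftC n J :=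
    fun a ha h => hL.mem_right <| by
      rw [hLP, splitBlocks, List.mem_flatMap]
      exact ⟨a, ha, by simp only [tagBlock, h, if_false]; simp⟩
  have hPblk : ∀ a ∈ l, NCMon.blk ⟨m.S.filter fun a => 0 ∈ P a, m.w.take n⟩ a = P a := by
    intro a ha
    ext (_ | t)
    · rw [NCMon.zero_mem_blk, Finset.mem_filter]
      exact ⟨fun h => h.2, fun h => ⟨(m.zero_mem_blk a).mp (hP a ha h), h⟩⟩
    · rw [NCMon.succ_mem_blk, List.getElem?_take]
      constructor
      · intro h
        split_ifs at h with htn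
        by_contra hc
        have hd : t + 1 ∈ m.blk a \ P a :=
          Finset.mem_sdiff.mpr ⟨(m.succ_mem_blk a t).mpr h, hc⟩
        have := le_of_succ_mem_of_mem_shiftC
          (hmemQ a ha (Finset.ne_empty_of_mem hd)) hd
        omega
      · intro h
        rw [if_pos (hI.lt_of_succ_mem (hmemP a ha (Finset.ne_empty_of_mem h)) h)]
        exact (m.succ_mem_blk a t).mp (hP a ha h)
  have hS : m.S.filter (fun a => 0 ∈ P a) ⊆ m.S := Finset.filter_subset _ _
  have heq : m.splitShuffle n (m.S.filter fun a => 0 ∈ P a) = L := by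
    rw [hLP]
    exact splitBlocks_congr hPblk
  have hsh := m.isShuffle_splitShuffle n hS
  rw [heq] at hsh
  refine ⟨_, hS, hsh.1.symm.trans hL.1, ?_, heq⟩
  exact (shiftB_injective n).list_map (hsh.2.symm.trans hL.2)

theorem finite_setOf_isShuffle (I J : List (Finset ℕ)) : {L | IsShuffle I J L}.Finite := by
  refine (I.map (Prod.mk false) ++ J.map (Prod.mk true)).permutations.finite_toSet.subset ?_
  rintro L ⟨rfl, rfl⟩
  change L ∈ List.permutations _
  rw [List.mem_permutations, List.map_map, List.map_map]
  have h1 : (L.filter fun p => !p.1).map (Prod.mk false ∘ Prod.snd) = L.filter fun p => !p.1 :=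
    (List.map_congr_left (g := id) (by
      rintro ⟨b, B⟩ h
      simpa using (List.mem_filter.mp h).2)).trans (List.map_id _)
  have h2 : (L.filter fun p => p.1).map (Prod.mk true ∘ Prod.snd) = L.filter fun p => p.1 :=
    (List.map_congr_left (g := id) (by
      rintro ⟨b, B⟩ h
      simpa using (List.mem_filter.mp h).2.symm)).trans (List.map_id _)
  rw [h1, h2]
  exact ((List.filter_append_perm (fun p => p.1) L).symm.trans List.perm_append_comm)

theorem finite_setOf_qMerge (L : List (Bool × Finset ℕ)) : {K | QMerge L K}.Finite := by
  induction hn : L.length using Nat.strong_induction_on generalizing L with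
  | _ n ih =>
    cases L with
    | nil =>
      refine (Set.finite_singleton []).subset ?_
      rintro K ⟨⟩
      rfl
    | cons p L =>
      simp only [List.length_cons] at hn
      have f1 := ih L.length (by omega) L rfl
      have f2 := ih L.tail.length (by simp; omega) L.tail rfl
      refine ((f1.image (List.cons p.2)).union
        (f2.image (List.cons (p.2 ∪ (L.headD (false, ∅)).2)))).subset ?_
      rintro K hK
      cases hK with
      | single b B L K h => exact Or.inl ⟨K, h, rfl⟩
      | merge B C L K h0 h => exact Or.inr ⟨K, h, rfl⟩

open Classical in
theorem finsum_quasiShuffle_apply (I J : List (Finset ℕ)) (m : NCMon) :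
    (∑ᶠ (L : List (Bool × Finset ℕ)) (K : List (Finset ℕ)) (_ : IsShuffle I J L)
      (_ : QMerge L K), ((-1 : ℚ) ^ eps L) • Mfn K) m =
      ∑ L ∈ (finite_setOf_isShuffle I J).toFinset with QMerge L m.scomp, (-1 : ℚ) ^ eps L := by
  simp only [finsum_eq_if]
  rw [finsum_apply]
  · have inner : ∀ L, (∑ᶠ K, if IsShuffle I J L then
        if QMerge L K then ((-1 : ℚ) ^ eps L) • Mfn K else 0 else 0) m =
        if IsShuffle I J L ∧ QMerge L m.scomp then (-1 : ℚ) ^ eps L else 0 := by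
      intro L
      rw [finsum_apply]
      · rw [finsum_eq_single _ m.scomp]
        · by_cases h1 : IsShuffle I J L <;> by_cases h2 : QMerge L m.scomp <;> simp [h1, h2, Mfn]
        · intro K hK
          by_cases h1 : IsShuffle I J L <;> by_cases h2 : QMerge L K <;>
            simp [h1, h2, Mfn, hK.symm]
      · refine (finite_setOf_qMerge L).subset fun K hK => ?_
        by_contra h
        exact hK (by simp_all)
    simp only [inner]
    rw [finsum_eq_finsetSum_of_support_subset (s := (finite_setOf_isShuffle I J).toFinset),
      Finset.sum_filter]
    · refine Finset.sum_congr rfl fun L hL => ?_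
      have : IsShuffle I J L := by simpa using hL
      simp [this]
    · intro L hL
      simp only [Set.Finite.coe_toFinset, Set.mem_ofPred_eq]
      by_contra h
      exact hL (by simp [h])
  · refine (finite_setOf_isShuffle I J).subset fun L hL => ?_
    by_contra h
    exact hL (by simp_all)

theorem mulF_Mfn_apply {I J : List (Finset ℕ)} (m : NCMon) :
    mulF (Mfn I) (Mfn J) m =
      ∑ S₁ ∈ m.S.powerset with NCMon.scomp ⟨S₁, m.w.take (unionNZ I).card⟩ = I ∧
        NCMon.scomp ⟨m.S \ S₁, m.w.drop (unionNZ I).card⟩ = J,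
        (-1 : ℚ) ^ invST S₁ (m.S \ S₁) := by
  have hlen : ∀ k S₁, NCMon.scomp ⟨S₁, m.w.take k⟩ = I → min k m.w.length = (unionNZ I).card := by
    intro k S₁ h
    rw [← h, NCMon.unionNZ_scomp]
    simp
  unfold mulF
  rw [Finset.sum_eq_single (unionNZ I).card, Finset.sum_filter]
  · refine Finset.sum_congr rfl fun S₁ _ => ?_
    unfold Mfn
    split_ifs <;> simp_all
  · intro k hk hkn
    refine Finset.sum_eq_zero fun S₁ _ => ?_
    have : NCMon.scomp ⟨S₁, m.w.take k⟩ ≠ I := fun h => by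
      have := hlen k S₁ h
      simp at hk
      omega
    simp [Mfn, this]
  · intro hn
    refine Finset.sum_eq_zero fun S₁ _ => ?_
    have : NCMon.scomp ⟨S₁, m.w.take (unionNZ I).card⟩ ≠ I := fun h => by
      have := hlen _ S₁ h
      simp at hn
      omega
    simp [Mfn, this]

theorem mulF_Mfn {I J : List (Finset ℕ)} (hI : IsSSC I) (hJ : IsSSC J) :
    mulF (Mfn I) (Mfn J) =
      ∑ᶠ (L : List (Bool × Finset ℕ)) (K : List (Finset ℕ))
        (_ : IsShuffle I (shiftC (unionNZ I).card J) L) (_ : QMerge L K),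
        ((-1 : ℚ) ^ eps L) • Mfn K := by
  funext m
  rw [finsum_quasiShuffle_apply, mulF_Mfn_apply]
  refine Finset.sum_bij (fun S₁ _ => m.splitShuffle (unionNZ I).card S₁) ?_ ?_ ?_ ?_
  · intro S₁ h
    simp only [Finset.mem_filter, Finset.mem_powerset] at h
    simp only [Finset.mem_filter, Set.Finite.mem_toFinset, Set.mem_ofPred_eq]
    have hs := m.isShuffle_splitShuffle (unionNZ I).card h.1
    rw [h.2.1, h.2.2] at hs
    exact ⟨hs, m.qMerge_splitShuffle _ h.1⟩
  · intro S₁ h₁ S₂ h₂ h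
    simp only [Finset.mem_filter, Finset.mem_powerset] at h₁ h₂
    exact m.splitShuffle_injOn _ h₁.1 h₂.1 h
  · intro L hL
    simp only [Finset.mem_filter, Set.Finite.mem_toFinset, Set.mem_ofPred_eq] at hL
    obtain ⟨S₁, h1, h2, h3, h4⟩ := exists_splitShuffle_eq hI hJ hL.1 hL.2
    exact ⟨S₁, by simp [h1, h2, h3], h4⟩
  · intro S₁ h
    simp only [Finset.mem_filter, Finset.mem_powerset] at h
    rw [m.eps_splitShuffle _ h.1]

theorem BddDeg.mulF {f g : NCMon → ℚ} (hf : BddDeg f) (hg : BddDeg g) : BddDeg (mulF f g) := by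
  obtain ⟨M, hM⟩ := hf
  obtain ⟨N, hN⟩ := hg
  refine ⟨M + N, fun u hu => ?_⟩
  obtain ⟨k, hk, hu⟩ := Finset.exists_ne_zero_of_sum_ne_zero hu
  obtain ⟨S₁, hS, hu⟩ := Finset.exists_ne_zero_of_sum_ne_zero hu
  have h1 := hM _ (right_ne_zero_of_mul (left_ne_zero_of_mul hu))
  have h2 := hN _ (right_ne_zero_of_mul hu)
  have h3 := Finset.card_sdiff_add_card_eq_card (Finset.mem_powerset.mp hS)
  simp only [NCMon.deg, List.length_take, List.length_drop] at h1 h2 ⊢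
  omega

/-- Relabelling of the indices of a monomial. -/
def NCMon.relabel (φ : ℕ → ℕ) (u : NCMon) : NCMon := ⟨u.S.image φ, u.w.map φ⟩

theorem NCMon.ind_relabel (φ : ℕ → ℕ) (u : NCMon) : (u.relabel φ).ind = u.ind.image φ := by
  ext a
  simp only [NCMon.ind, NCMon.relabel, Finset.mem_union, Finset.mem_image, List.mem_toFinset,
    List.mem_map]
  grind

theorem rk_image {φ : ℕ → ℕ} {A : Finset ℕ} (hφ : StrictMonoOn φ A) {a : ℕ} (ha : a ∈ A) :
    rk (A.image φ) (φ a) = rk A a := by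
  unfold rk
  rw [Finset.filter_image, Finset.card_image_of_injOn (hφ.injOn.mono fun x hx => (by simp_all))]
  congr 1
  exact Finset.filter_congr fun b hb => hφ.le_iff_le hb ha

theorem NCMon.std_relabel {φ : ℕ → ℕ} {u : NCMon} (hφ : StrictMonoOn φ u.ind) :
    (u.relabel φ).std = u.std := by
  unfold NCMon.std
  rw [NCMon.ind_relabel]
  simp only [NCMon.relabel, Finset.image_image, List.map_map]
  congr 1
  · exact Finset.image_congr fun a ha => rk_image hφ (Finset.mem_union_left _ ha)
  · exact List.map_congr_left fun a ha =>
      rk_image hφ (Finset.mem_union_right _ (List.mem_toFinset.mpr ha))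

theorem invST_image {φ : ℕ → ℕ} {A S T : Finset ℕ} (hφ : StrictMonoOn φ A) (hS : S ⊆ A)
    (hT : T ⊆ A) : invST (S.image φ) (T.image φ) = invST S T := by
  have hinj : ∀ X ⊆ A, Set.InjOn φ X := fun X hX => hφ.injOn.mono (by simpa using hX)
  rw [invST_eq_sum, invST_eq_sum, Finset.sum_image (hinj T hT)]
  refine Finset.sum_congr rfl fun t ht => ?_
  rw [Finset.filter_image, Finset.card_image_of_injOn (hinj _ ((Finset.filter_subset _ _).trans hS))]
  congr 1
  exact Finset.filter_congr fun s hs => hφ.lt_iff_lt (hT ht) (hS hs)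

theorem mulF_relabel {f g : NCMon → ℚ} (hf : QSymNC f) (hg : QSymNC g) {φ : ℕ → ℕ} {u : NCMon}
    (hφ : StrictMonoOn φ u.ind) : mulF f g (u.relabel φ) = mulF f g u := by
  have hSind : u.S ⊆ u.ind := Finset.subset_union_left
  have hinj : Set.InjOn φ u.S := hφ.injOn.mono (by simpa using hSind)
  unfold mulF
  simp only [NCMon.relabel, List.length_map]
  refine Finset.sum_congr rfl fun k _ => ?_
  rw [Finset.powerset_image, Finset.sum_image]
  · refine Finset.sum_congr rfl fun S₁ hS => ?_
    rw [Finset.mem_powerset] at hS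
    have hsd : u.S.image φ \ S₁.image φ = (u.S \ S₁).image φ :=
      (Finset.image_sdiff_of_injOn hinj hS).symm
    rw [hsd, invST_image hφ (hS.trans hSind) (Finset.sdiff_subset.trans hSind)]
    have hfk : f ⟨S₁.image φ, (u.w.take k).map φ⟩ = f ⟨S₁, u.w.take k⟩ := by
      refine hf _ _ (NCMon.std_relabel (u := ⟨S₁, u.w.take k⟩) (hφ.mono ?_))
      exact_mod_cast Finset.union_subset_union hS fun a => by simpa using List.mem_of_mem_take
    have hgk : g ⟨(u.S \ S₁).image φ, (u.w.drop k).map φ⟩ = g ⟨u.S \ S₁, u.w.drop k⟩ := by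
      refine hg _ _ (NCMon.std_relabel (u := ⟨u.S \ S₁, u.w.drop k⟩) (hφ.mono ?_))
      exact_mod_cast Finset.union_subset_union Finset.sdiff_subset
        fun a => by simpa using List.mem_of_mem_drop
    rw [← List.map_take, ← List.map_drop, hfk, hgk]
  · intro S₁ h₁ S₂ h₂ h
    have h₁' : S₁ ⊆ u.S := by simpa using h₁
    have h₂' : S₂ ⊆ u.S := by simpa using h₂
    have := (hinj.image_eq_image_iff (s₁ := (S₁ : Set ℕ)) (s₂ := (S₂ : Set ℕ))
      (by exact_mod_cast h₁') (by exact_mod_cast h₂')).mp (by exact_mod_cast h)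
    exact_mod_cast this

theorem QSymNC.mulF {f g : NCMon → ℚ} (hf : QSymNC f) (hg : QSymNC g) : QSymNC (mulF f g) := by
  have hstd : ∀ u : NCMon, _root_.mulF f g u.std = _root_.mulF f g u :=
    fun u => mulF_relabel hf hg (rk_strictMonoOn u.ind)
  intro u v h
  rw [← hstd u, h, hstd v]

/-- **Proposition.** For set supercompositions `I` and `J`,
`M_I · M_J = ∑_{K ∈ QSh(I,J)} sgn(K) M_K`, the sum running over all `(I,J)`-quasi-shuffles
`K` (pairs of an underlying tagged shuffle `L` of `I` and `J[n]` and a resulting merged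
sequence `K`), with sign `(-1)^{ε(L)}`. Consequently, `sNCQSym` is closed under
multiplication. -/
theorem mul_monomial_sNCQSym :
    (∀ I J : List (Finset ℕ), IsSSC I → IsSSC J →
      mulF (Mfn I) (Mfn J) =
        ∑ᶠ (L : List (Bool × Finset ℕ)) (K : List (Finset ℕ))
          (_ : IsShuffle I (shiftC (unionNZ I).card J) L) (_ : QMerge L K),
          ((-1 : ℚ) ^ eps L) • Mfn K) ∧
    (∀ f g : NCMon → ℚ, BddDeg f → QSymNC f → BddDeg g → QSymNC g →
      BddDeg (mulF f g) ∧ QSymNC (mulF f g)) := by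
  exact ⟨fun _ _ hI hJ => mulF_Mfn hI hJ, fun _ _ hf hfq hg hgq => ⟨hf.mulF hg, hfq.mulF hgq⟩⟩
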